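/- Let n ≥ 2 be an integer and let N := n(n−1)/2 index the pairs 1 ≤ i < j ≤ n. Define Q_ord := {(x, ζ) ∈ ℝ^n × ℝ^N : (x_j − x_i)^2 ≥ ζ_{ij} for all 1 ≤ i < j ≤ n, and 0 ≤ x_1 ≤ x_2 ≤ … ≤ x_n ≤ 1}. Then the convex hull of Q_ord equals the polyhedron {(x, ζ) ∈ ℝ^n × ℝ^N : x_j − x_i ≥ ζ_{ij} for all 1 ≤ i < j ≤ n, and 0 ≤ x_1 ≤ x_2 ≤ … ≤ x_n ≤ 1}. -/

import Mathlib

/-- The convex hull of the ordered lifted set `Q_ord` (the x-part of the circle packing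
problem under the order constraints, with `ζ_{ij}` underestimating `(x_j - x_i)²`)
is the polyhedron obtained by replacing each `(x_j - x_i)² ≥ ζ_{ij}` with
`x_j - x_i ≥ ζ_{ij}`.  Pairs `i < j` are indexed by the subtype
`{q : Fin n × Fin n // q.1 < q.2}` (of cardinality `n(n-1)/2`). -/
theorem stmt_12 (n : ℕ) (hn : 2 ≤ n) :
    convexHull ℝ
      {p : (Fin n → ℝ) × ({q : Fin n × Fin n // q.1 < q.2} → ℝ) |
        (∀ q : {q : Fin n × Fin n // q.1 < q.2},
          (p.1 q.1.2 - p.1 q.1.1)^2 ≥ p.2 q) ∧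
        (∀ i, 0 ≤ p.1 i ∧ p.1 i ≤ 1) ∧ Monotone p.1} =
    {p : (Fin n → ℝ) × ({q : Fin n × Fin n // q.1 < q.2} → ℝ) |
      (∀ q : {q : Fin n × Fin n // q.1 < q.2},
        p.1 q.1.2 - p.1 q.1.1 ≥ p.2 q) ∧
      (∀ i, 0 ≤ p.1 i ∧ p.1 i ≤ 1) ∧ Monotone p.1} := by
  apply Set.Subset.antisymm
  · apply convexHull_min
    · rintro ⟨x, z⟩ ⟨h1, h2, h3⟩
      refine ⟨fun q => ?_, h2, h3⟩
      have a := h1 q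
      have b := h3 q.2.le
      have c := h2 q.1.1
      have d := h2 q.1.2
      simp only at a b c d ⊢
      nlinarith
    · rintro ⟨x, z⟩ ⟨h1, h2, h3⟩ ⟨x', z'⟩ ⟨h1', h2', h3'⟩ a b ha hb hab
      refine ⟨fun q => ?_, fun i => ⟨?_, ?_⟩, fun i j hij => ?_⟩
      · have e := mul_le_mul_of_nonneg_left (h1 q) ha
        have f := mul_le_mul_of_nonneg_left (h1' q) hb
        simp at e f ⊢
        linarith
      · have e := mul_nonneg ha (h2 i).1
        have f := mul_nonneg hb (h2' i).1
        simp at e f ⊢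
        linarith
      · have e := mul_le_mul_of_nonneg_left (h2 i).2 ha
        have f := mul_le_mul_of_nonneg_left (h2' i).2 hb
        simp at e f ⊢
        linarith
      · have e := mul_le_mul_of_nonneg_left (h3 hij) ha
        have f := mul_le_mul_of_nonneg_left (h3' hij) hb
        simp at e f ⊢
        linarith
  · rintro ⟨x, z⟩ ⟨h1, h2, h3⟩
    simp only at h1 h2 h3
    let y : ℕ → ℝ := fun k => if k = 0 then 0 else if h : k - 1 < n then x ⟨k - 1, h⟩ else 1
    have y0 : y 0 = 0 := by simp [y]
    have y1 : y (n + 1) = 1 := by simp [y]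
    have yi : ∀ i : Fin n, y (i + 1) = x i := fun i => by simp [y]
    have ymono : ∀ k, 0 ≤ y (k + 1) - y k := by
      intro k
      rw [sub_nonneg]
      rcases k with _ | k
      · rw [y0]
        simp only [y]
        split_ifs <;> first | exact (h2 _).1 | norm_num
      · simp only [y, Nat.add_sub_cancel, Nat.succ_ne_zero, if_false]
        split_ifs
        · apply h3
          simp
        · exact (h2 _).2
        · omega
        · exact le_rfl
    have hsum : ∑ k ∈ Finset.range (n + 1), (y (k + 1) - y k) = 1 := by
      rw [Finset.sum_range_sub, y0, y1, sub_zero]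
    have hx : ∀ i : Fin n, ∑ k ∈ Finset.range (n + 1),
        (y (k + 1) - y k) * (if k ≤ (i : ℕ) then (1 : ℝ) else 0) = x i := by
      intro i
      have : Finset.filter (fun k => k ≤ (i : ℕ)) (Finset.range (n + 1))
          = Finset.range ((i : ℕ) + 1) := by
        ext k
        have := i.2
        simp only [Finset.mem_filter, Finset.mem_range]
        omega
      simp only [mul_ite, mul_one, mul_zero]
      rw [← Finset.sum_filter, this, Finset.sum_range_sub, y0, sub_zero, yi]
    let v : ℕ → Fin n → ℝ := fun k i => if k ≤ (i : ℕ) then (1 : ℝ) else 0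
    let P : ℕ → (Fin n → ℝ) × ({q : Fin n × Fin n // q.1 < q.2} → ℝ) := fun k =>
      (v k, fun q => v k q.1.2 - v k q.1.1 - (x q.1.2 - x q.1.1 - z q))
    have key : (x, z) = ∑ k ∈ Finset.range (n + 1), (y (k + 1) - y k) • P k := by
      apply Prod.ext
      · funext i
        rw [Prod.fst_sum, Finset.sum_apply]
        exact (hx i).symm
      · funext q
        rw [Prod.snd_sum, Finset.sum_apply]
        simp only [P, Prod.smul_mk, Pi.smul_apply, smul_eq_mul, mul_sub,
          Finset.sum_sub_distrib]
        simp only [← Finset.sum_mul, hsum, v, hx]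
        ring
    rw [key]
    refine (convex_convexHull ℝ _).sum_mem (fun k _ => ymono k) hsum fun k _ => ?_
    apply subset_convexHull
    refine ⟨fun q => ?_, fun i => ?_, fun i j hij => ?_⟩
    · have a := h1 q
      have b : (q.1.1 : ℕ) < q.1.2 := q.2
      simp only [P, v]
      split_ifs <;> first | omega | linarith
    · simp only [P, v]
      split_ifs <;> norm_num
    · have b : (i : ℕ) ≤ j := hij
      simp only [P, v]
      split_ifs <;> first | omega | norm_num
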